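/- Let S ≥ 1 be an integer, E ≥ 1 an integer, σ > 0, and set τ := σ/√E. Let P_SP := (1/S)·∑_{s=1}^S N(2e_s, τ²I_S) and Q_SP := (1/S)·∑_{s=1}^S N(e_s, τ²I_S) on ℝ^S. Then for every ε ≥ 0, D_{e^ε}(P_SP ‖ Q_SP) ≥ sup_{C ∈ ℝ} [ (1 − Φ((C−2)/τ)·Φ(C/τ)^{S−1}) − e^ε·(1 − Φ((C−1)/τ)·Φ(C/τ)^{S−1}) ]. -/

import Mathlib

open MeasureTheory ProbabilityTheory
open scoped ENNReal NNReal

/-- Hockey-stick divergence `D_{e^ε}(P ‖ Q) = sup_Γ (P(Γ) − e^ε·Q(Γ))`,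
where the supremum is over measurable sets `Γ`. -/
noncomputable def hsDiv {Ω : Type*} [MeasurableSpace Ω] (ε : ℝ) (P Q : Measure Ω) : ℝ :=
  ⨆ Γ : {s : Set Ω // MeasurableSet s}, ((P Γ.1).toReal - Real.exp ε * (Q Γ.1).toReal)

/-- CDF of the standard normal distribution. -/
noncomputable def stdNormalCDF (x : ℝ) : ℝ := ((gaussianReal 0 1) (Set.Iic x)).toReal

lemma gauss_Iic (μ τ C : ℝ) (hτ : 0 < τ) :
    ((gaussianReal μ (Real.toNNReal (τ ^ 2))) (Set.Iic C)).toReal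
      = stdNormalCDF ((C - μ) / τ) := by
  have h : gaussianReal μ (Real.toNNReal (τ ^ 2))
      = (gaussianReal 0 1).map (fun x => τ * x + μ) := by
    have h1 : (fun x : ℝ => τ * x + μ) = (fun x => x + μ) ∘ (fun x => τ * x) := rfl
    rw [h1, ← Measure.map_map (by fun_prop) (by fun_prop), gaussianReal_map_const_mul,
      gaussianReal_map_add_const]
    congr 1
    · simp
    · ext
      simp [sq_nonneg]
  rw [h, Measure.map_apply (by fun_prop) measurableSet_Iic, stdNormalCDF]
  congr 2
  ext x
  simp only [Set.mem_preimage, Set.mem_Iic]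
  rw [le_div_iff₀ hτ]
  constructor <;> intro h <;> linarith

lemma mix_prob (S : ℕ) (hS : 1 ≤ S) (m τ : ℝ) :
    IsProbabilityMeasure (((S : ℝ≥0∞))⁻¹ •
            ∑ s : Fin S, Measure.pi fun i : Fin S =>
              gaussianReal (if i = s then m else 0) (Real.toNNReal (τ ^ 2))) := by
  constructor
  simp only [Measure.smul_apply, Measure.coe_finsetSum, Finset.sum_apply, measure_univ,
    Finset.sum_const, Finset.card_univ, Fintype.card_fin, smul_eq_mul, nsmul_eq_mul, mul_one]
  exact ENNReal.inv_mul_cancel (by simp; omega) (by simp)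

lemma mix_compl (S : ℕ) (hS : 1 ≤ S) (m τ C : ℝ) (hτ : 0 < τ) :
    ((((S : ℝ≥0∞))⁻¹ •
            ∑ s : Fin S, Measure.pi fun i : Fin S =>
              gaussianReal (if i = s then m else 0) (Real.toNNReal (τ ^ 2)))
      (Set.pi Set.univ fun _ : Fin S => Set.Iic C)ᶜ).toReal
      = 1 - stdNormalCDF ((C - m) / τ) * stdNormalCDF (C / τ) ^ (S - 1) := by
  have := mix_prob S hS m τ
  have hS0 : (S : ℝ) ≠ 0 := by positivity
  rw [prob_compl_eq_one_sub (MeasurableSet.univ_pi fun _ => measurableSet_Iic),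
    ENNReal.toReal_sub_of_le prob_le_one (by simp)]
  simp only [ENNReal.toReal_one, Measure.smul_apply, Measure.coe_finsetSum, Finset.sum_apply,
    smul_eq_mul, ENNReal.toReal_mul, ENNReal.toReal_inv, ENNReal.toReal_natCast]
  rw [ENNReal.toReal_sum (fun _ _ => measure_ne_top _ _)]
  have key : ∀ s : Fin S, ((Measure.pi fun i : Fin S =>
        gaussianReal (if i = s then m else 0) (Real.toNNReal (τ ^ 2)))
        (Set.pi Set.univ fun _ : Fin S => Set.Iic C)).toReal
      = stdNormalCDF ((C - m) / τ) * stdNormalCDF (C / τ) ^ (S - 1) := by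
    intro s
    rw [Measure.pi_pi, ENNReal.toReal_prod]
    simp only [gauss_Iic _ _ _ hτ]
    rw [← Finset.mul_prod_erase _ _ (Finset.mem_univ s)]
    rw [Finset.prod_congr rfl (g := fun _ => stdNormalCDF (C / τ))]
    · simp [Finset.card_erase_of_mem]
    · intro i hi
      simp [Finset.ne_of_mem_erase hi]
  simp only [key, Finset.sum_const, Finset.card_univ, Fintype.card_fin, nsmul_eq_mul]
  field_simp

theorem stmt_11 (S : ℕ) (hS : 1 ≤ S) (E : ℕ) (hE : 1 ≤ E) (σ : ℝ) (hσ : 0 < σ)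
    (τ : ℝ) (hτ : τ = σ / Real.sqrt E) (ε : ℝ) (hε : 0 ≤ ε) :
    (⨆ C : ℝ,
        ((1 - stdNormalCDF ((C - 2) / τ) * stdNormalCDF (C / τ) ^ (S - 1))
          - Real.exp ε * (1 - stdNormalCDF ((C - 1) / τ) * stdNormalCDF (C / τ) ^ (S - 1))))
      ≤ hsDiv ε
          -- `P_SP = (1/S)·∑_s N(2e_s, τ²I_S)`
          (((S : ℝ≥0∞))⁻¹ •
            ∑ s : Fin S, Measure.pi fun i : Fin S =>
              gaussianReal (if i = s then 2 else 0) (Real.toNNReal (τ ^ 2)))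
          -- `Q_SP = (1/S)·∑_s N(e_s, τ²I_S)`
          (((S : ℝ≥0∞))⁻¹ •
            ∑ s : Fin S, Measure.pi fun i : Fin S =>
              gaussianReal (if i = s then 1 else 0) (Real.toNNReal (τ ^ 2))) := by
  have hτ0 : 0 < τ := by
    rw [hτ]
    have : (0 : ℝ) < E := by exact_mod_cast hE
    positivity
  refine ciSup_le fun C => ?_
  rw [← mix_compl S hS 2 τ C hτ0, ← mix_compl S hS 1 τ C hτ0]
  have := mix_prob S hS 2 τ
  unfold hsDiv
  refine le_ciSup_of_le ⟨1, ?_⟩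
    ⟨(Set.pi Set.univ fun _ : Fin S => Set.Iic C)ᶜ,
      (MeasurableSet.univ_pi fun _ => measurableSet_Iic).compl⟩ le_rfl
  rintro _ ⟨Γ, rfl⟩
  refine (sub_le_self _ (by positivity)).trans ?_
  exact measureReal_le_one
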